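/- Let g ≥ 2 be an integer and i an integer with i ≡ 3 (mod 4). If g is even, then there exists a natural number n such that i + n(4g−4) ≡ 6g−1 (mod 8g−4); if g is odd, then there exists a natural number n such that i + n(4g−4) ≡ 2g+1 (mod 8g−4). -/

import Mathlib

/-- Since `g - 1` is invertible modulo `2 * g - 1` (with inverse `-2`), the progression
`i + n * (4 * g - 4)` meets every class modulo `8 * g - 4` that agrees with `i` modulo `4`. -/
theorem exists_nat_add_mul_modEq {g i t : ℤ} (hg : 1 ≤ g) (h : i ≡ t [ZMOD 4]) :
    ∃ n : ℕ, i + (n : ℤ) * (4*g - 4) ≡ t [ZMOD 8*g - 4] := by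
  obtain ⟨c, hc⟩ := Int.modEq_iff_dvd.mp h
  have hn : 0 ≤ (-2 * c) % (2*g - 1) := Int.emod_nonneg _ (by omega)
  have hdiv := Int.emod_add_mul_ediv (-2 * c) (2*g - 1)
  refine ⟨((-2 * c) % (2*g - 1)).toNat, Int.modEq_iff_dvd.mpr
    ⟨c + (g - 1) * ((-2 * c) / (2*g - 1)), ?_⟩⟩
  rw [Int.toNat_of_nonneg hn]
  linear_combination hc - (4*g - 4) * hdiv

theorem hits_class_three_mod_four (g i : ℤ) (hg : 2 ≤ g) (hi : i ≡ 3 [ZMOD 4]) :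
    (Even g → ∃ n : ℕ, i + (n : ℤ) * (4*g - 4) ≡ 6*g - 1 [ZMOD 8*g - 4]) ∧
    (Odd g → ∃ n : ℕ, i + (n : ℤ) * (4*g - 4) ≡ 2*g + 1 [ZMOD 8*g - 4]) := by
  constructor
  · rintro ⟨k, rfl⟩
    exact exists_nat_add_mul_modEq (by omega) (by unfold Int.ModEq at *; omega)
  · rintro ⟨k, rfl⟩
    exact exists_nat_add_mul_modEq (by omega) (by unfold Int.ModEq at *; omega)
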